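/- Let λ denote the principal Dirichlet eigenvalue of the negative Laplacian. For any bounded nonempty open convex sets U, V ⊆ ℝ² and any α ∈ [0,1], λ(αU + (1−α)V) ≤ αλ(U) + (1−α)λ(V), where the sum is the Minkowski combination. -/

import Mathlib

open Set Metric MeasureTheory Filter Pointwise Asymptotics

noncomputable section

abbrev E2 := EuclideanSpace ℝ (Fin 2)

/-- `ρ` is a norm on the plane. -/
def IsNorm (ρ : E2 → ℝ) : Prop :=
  (∀ x, ρ x = 0 ↔ x = 0) ∧ (∀ (c : ℝ) (x : E2), ρ (c • x) = |c| * ρ x) ∧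
    ∀ x y, ρ (x + y) ≤ ρ x + ρ y

/-- The `ρ`-length of a curve `γ` on `[0,1]`, as the supremum over inscribed polygons. -/
def polyPerim (ρ : E2 → ℝ) (γ : ℝ → E2) : ℝ :=
  sSup {L | ∃ n : ℕ, ∃ t : Fin (n + 1) → ℝ, StrictMono t ∧ t 0 = 0 ∧ t (Fin.last n) = 1 ∧
    L = ∑ i : Fin n, ρ (γ (t i.succ) - γ (t i.castSucc))}

/-- `γ` is a simple closed curve on `[0,1]` parametrizing the boundary of `U`. -/
def JordanParam (U : Set E2) (γ : ℝ → E2) : Prop :=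
  ContinuousOn γ (Icc 0 1) ∧ γ 0 = γ 1 ∧ InjOn γ (Ico 0 1) ∧ γ '' Icc 0 1 = frontier U

/-- `U` is a Jordan domain. -/
def IsJordanDomain (U : Set E2) : Prop :=
  IsOpen U ∧ Bornology.IsBounded U ∧ ∃ γ : ℝ → E2, JordanParam U γ

/-- The `ρ`-perimeter of a set. -/
def setPerim (ρ : E2 → ℝ) (U : Set E2) : ℝ :=
  sSup {L | ∃ γ : ℝ → E2, JordanParam U γ ∧ L = polyPerim ρ γ}

/-- The principal Dirichlet eigenvalue of the negative Laplacian on `U`. -/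
def eigen (U : Set E2) : ℝ :=
  sInf {L | ∃ g : E2 → ℝ, ContDiff ℝ (⊤ : ℕ∞) g ∧ tsupport g ⊆ U ∧ (∫ x, (g x) ^ 2) = 1 ∧
    L = ∫ x, ‖gradient g x‖ ^ 2}

/-- The functional `ℱ = λ + 𝒫`. -/
def Ffun (ρ : E2 → ℝ) (U : Set E2) : ℝ := eigen U + setPerim ρ U


/-- One-dimensional Brunn–Minkowski inequality for compact sets. -/
theorem volume_add_volume_le_of_isCompact {K L C : Set ℝ} (hK : IsCompact K) (hL : IsCompact L)
    (hKne : K.Nonempty) (hLne : L.Nonempty) (hC : ∀ x ∈ K, ∀ y ∈ L, x + y ∈ C) :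
    volume K + volume L ≤ volume C := by
  obtain ⟨a, haK, ha⟩ := hK.exists_isGreatest hKne
  obtain ⟨b, hbL, hb⟩ := hL.exists_isLeast hLne
  have hL' : MeasurableSet ((fun y => a + y) '' L) :=
    (hL.image (by fun_prop)).measurableSet
  have hdisj : AEDisjoint volume ((fun x => x + b) '' K) ((fun y => a + y) '' L) := by
    refine measure_mono_null (t := {a + b}) ?_ (by simp)
    rintro z ⟨⟨x, hx, rfl⟩, ⟨y, hy, hxy⟩⟩
    have h1 := ha hx
    have h2 := hb hy
    simp only [mem_singleton_iff] at *
    linarith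
  have hsub : ((fun x => x + b) '' K) ∪ ((fun y => a + y) '' L) ⊆ C := by
    rintro z (⟨x, hx, rfl⟩ | ⟨y, hy, rfl⟩)
    · exact hC x hx b hbL
    · exact hC a haK y hy
  calc volume K + volume L
      = volume ((fun x => x + b) '' K) + volume ((fun y => a + y) '' L) := by
        rw [image_add_right, image_add_left, measure_preimage_add_right, measure_preimage_add]
    _ = volume (((fun x => x + b) '' K) ∪ ((fun y => a + y) '' L)) :=
        (measure_union₀ hL'.nullMeasurableSet hdisj).symm
    _ ≤ volume C := measure_mono hsub

/-- One-dimensional Brunn–Minkowski inequality for measurable sets. -/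
theorem volume_add_volume_le {A B C : Set ℝ} (hA : MeasurableSet A) (hB : MeasurableSet B)
    (hAne : A.Nonempty) (hBne : B.Nonempty) (hC : ∀ x ∈ A, ∀ y ∈ B, x + y ∈ C) :
    volume A + volume B ≤ volume C := by
  obtain ⟨a, ha⟩ := hAne
  obtain ⟨b, hb⟩ := hBne
  rw [hA.measure_eq_iSup_isCompact, hB.measure_eq_iSup_isCompact]
  simp only [iSup_and']
  refine ENNReal.biSup_add_biSup_le' (p := fun K => K ⊆ A ∧ IsCompact K)
    (q := fun K => K ⊆ B ∧ IsCompact K) ⟨∅, by simp⟩ ⟨∅, by simp⟩ ?_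
  rintro K ⟨hKA, hK⟩ L ⟨hLB, hL⟩
  calc volume K + volume L ≤ volume (insert a K) + volume (insert b L) := by
        gcongr <;> exact subset_insert _ _
    _ ≤ volume C := volume_add_volume_le_of_isCompact (hK.insert a) (hL.insert b)
        (insert_nonempty _ _) (insert_nonempty _ _) fun x hx y hy =>
          hC x (insert_subset ha hKA hx) y (insert_subset hb hLB hy)

theorem weighted_volume_add_le {A B C : Set ℝ} {α β : ℝ} (hα : 0 < α) (hβ : 0 < β)
    (hA : MeasurableSet A) (hB : MeasurableSet B)
    (hAne : A.Nonempty) (hBne : B.Nonempty) (hC : ∀ x ∈ A, ∀ y ∈ B, α * x + β * y ∈ C) :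
    ENNReal.ofReal α * volume A + ENNReal.ofReal β * volume B ≤ volume C := by
  have h := volume_add_volume_le (A := α • A) (B := β • B) (C := C)
    (hA.const_smul₀ α) (hB.const_smul₀ β) (hAne.smul_set) (hBne.smul_set) (by
      rintro _ ⟨x, hx, rfl⟩ _ ⟨y, hy, rfl⟩
      exact hC x hx y hy)
  simpa [Measure.addHaar_smul, abs_of_pos hα, abs_of_pos hβ] using h

theorem lintegral_weighted_add_le {f g h : ℝ → ℝ} {α β : ℝ} (hα : 0 < α) (hβ : 0 < β)
    (hf : Measurable f) (hg : Measurable g) (hh : Measurable h)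
    (hf0 : ∀ x, 0 ≤ f x) (hg0 : ∀ x, 0 ≤ g x) (hh0 : ∀ x, 0 ≤ h x)
    (hf1 : ∀ x, f x ≤ 1) (hg1 : ∀ x, g x ≤ 1)
    (hfs : ∀ t < 1, ∃ x, t < f x) (hgs : ∀ t < 1, ∃ x, t < g x)
    (H : ∀ t x y, 0 < t → t < f x → t < g y → t < h (α * x + β * y)) :
    ENNReal.ofReal α * (∫⁻ x, ENNReal.ofReal (f x)) +
      ENNReal.ofReal β * (∫⁻ x, ENNReal.ofReal (g x)) ≤ ∫⁻ x, ENNReal.ofReal (h x) := by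
  rw [lintegral_eq_lintegral_meas_lt _ (ae_of_all _ hf0) hf.aemeasurable,
    lintegral_eq_lintegral_meas_lt _ (ae_of_all _ hg0) hg.aemeasurable,
    lintegral_eq_lintegral_meas_lt _ (ae_of_all _ hh0) hh.aemeasurable,
    ← lintegral_const_mul' _ _ ENNReal.ofReal_ne_top,
    ← lintegral_const_mul' _ _ ENNReal.ofReal_ne_top]
  have hmf : Measurable fun t => ENNReal.ofReal α * volume {a | t < f a} := by
    refine Measurable.const_mul (Antitone.measurable fun s t hst => measure_mono ?_) _
    exact fun x hx => lt_of_le_of_lt hst hx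
  rw [← lintegral_add_left hmf]
  refine setLIntegral_mono' measurableSet_Ioi fun t ht => ?_
  rcases lt_or_ge t 1 with h1 | h1
  · exact weighted_volume_add_le hα hβ (measurableSet_lt measurable_const hf)
      (measurableSet_lt measurable_const hg) (hfs t h1) (hgs t h1)
      fun x hx y hy => H t x y ht hx hy
  · have e1 : {a | t < f a} = ∅ := eq_empty_of_forall_notMem fun x hx =>
      absurd (lt_of_le_of_lt h1 hx) (not_lt.2 (hf1 x))
    have e2 : {a | t < g a} = ∅ := eq_empty_of_forall_notMem fun x hx =>
      absurd (lt_of_le_of_lt h1 hx) (not_lt.2 (hg1 x))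
    simp [e1, e2]

theorem prekopaLeindler_of_iSup {f g h : ℝ → ℝ} {α β : ℝ} (hα : 0 < α) (hβ : 0 < β)
    (hαβ : α + β = 1)
    (hf : Integrable f) (hg : Integrable g) (hh : Integrable h)
    (hfm : Measurable f) (hgm : Measurable g) (hhm : Measurable h)
    (hf0 : ∀ x, 0 ≤ f x) (hg0 : ∀ x, 0 ≤ g x) (hh0 : ∀ x, 0 ≤ h x)
    (hf1 : ∀ x, f x ≤ 1) (hg1 : ∀ x, g x ≤ 1)
    (hfs : ∀ t < 1, ∃ x, t < f x) (hgs : ∀ t < 1, ∃ x, t < g x)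
    (H : ∀ x y, f x ^ α * g y ^ β ≤ h (α * x + β * y)) :
    α * (∫ x, f x) + β * (∫ x, g x) ≤ ∫ x, h x := by
  have key := lintegral_weighted_add_le hα hβ hfm hgm hhm hf0 hg0 hh0 hf1 hg1 hfs hgs
    (fun t x y ht hx hy => by
      calc t = t ^ α * t ^ β := by rw [← Real.rpow_add ht, hαβ, Real.rpow_one]
        _ < f x ^ α * g y ^ β := by
          gcongr
        _ ≤ _ := H x y)
  rw [← ofReal_integral_eq_lintegral_ofReal hf (ae_of_all _ hf0),
    ← ofReal_integral_eq_lintegral_ofReal hg (ae_of_all _ hg0),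
    ← ofReal_integral_eq_lintegral_ofReal hh (ae_of_all _ hh0),
    ← ENNReal.ofReal_mul hα.le, ← ENNReal.ofReal_mul hβ.le,
    ← ENNReal.ofReal_add (mul_nonneg hα.le (integral_nonneg hf0))
      (mul_nonneg hβ.le (integral_nonneg hg0)),
    ENNReal.ofReal_le_ofReal_iff (integral_nonneg hh0)] at key
  exact key

/-- The one-dimensional Prékopa–Leindler inequality for bounded functions. -/
theorem prekopaLeindler {f g h : ℝ → ℝ} {α β : ℝ} (hα : 0 < α) (hβ : 0 < β)
    (hαβ : α + β = 1)
    (hf : Integrable f) (hg : Integrable g) (hh : Integrable h)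
    (hfm : Measurable f) (hgm : Measurable g) (hhm : Measurable h)
    (hf0 : ∀ x, 0 ≤ f x) (hg0 : ∀ x, 0 ≤ g x) (hh0 : ∀ x, 0 ≤ h x)
    (hfb : BddAbove (range f)) (hgb : BddAbove (range g))
    (H : ∀ x y, f x ^ α * g y ^ β ≤ h (α * x + β * y)) :
    (∫ x, f x) ^ α * (∫ x, g x) ^ β ≤ ∫ x, h x := by
  rcases eq_or_ne f 0 with rfl | hfne
  · simpa [Real.zero_rpow hα.ne'] using integral_nonneg hh0
  rcases eq_or_ne g 0 with rfl | hgne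
  · simpa [Real.zero_rpow hβ.ne'] using integral_nonneg hh0
  have pos : ∀ {f : ℝ → ℝ}, (∀ x, 0 ≤ f x) → BddAbove (range f) → f ≠ 0 → 0 < ⨆ x, f x := by
    intro f h0 hb hne
    obtain ⟨x, hx⟩ := Function.ne_iff.1 hne
    exact lt_of_lt_of_le (lt_of_le_of_ne (h0 x) (Ne.symm hx)) (le_ciSup hb x)
  set a := ⨆ x, f x with ha
  set b := ⨆ x, g x with hb
  have ha0 : 0 < a := pos hf0 hfb hfne
  have hb0 : 0 < b := pos hg0 hgb hgne
  have hc0 : 0 < a ^ α * b ^ β := by positivity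
  have key := prekopaLeindler_of_iSup (f := fun x => f x / a) (g := fun x => g x / b)
    (h := fun x => h x / (a ^ α * b ^ β)) hα hβ hαβ (hf.div_const _) (hg.div_const _)
    (hh.div_const _) (hfm.div_const _) (hgm.div_const _) (hhm.div_const _)
    (fun x => div_nonneg (hf0 x) ha0.le) (fun x => div_nonneg (hg0 x) hb0.le)
    (fun x => div_nonneg (hh0 x) hc0.le)
    (fun x => (div_le_one ha0).2 (le_ciSup hfb x)) (fun x => (div_le_one hb0).2 (le_ciSup hgb x))
    (fun t ht => by
      obtain ⟨x, hx⟩ := exists_lt_of_lt_ciSup (show t * a < ⨆ x, f x by rw [← ha]; nlinarith)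
      exact ⟨x, (lt_div_iff₀ ha0).2 hx⟩)
    (fun t ht => by
      obtain ⟨x, hx⟩ := exists_lt_of_lt_ciSup (show t * b < ⨆ x, g x by rw [← hb]; nlinarith)
      exact ⟨x, (lt_div_iff₀ hb0).2 hx⟩)
    (fun x y => by
      rw [Real.div_rpow (hf0 x) ha0.le, Real.div_rpow (hg0 y) hb0.le, div_mul_div_comm]
      gcongr
      exact H x y)
  simp only [integral_div] at key
  have hF : 0 ≤ ∫ x, f x := integral_nonneg hf0
  have hG : 0 ≤ ∫ x, g x := integral_nonneg hg0
  have amgm := Real.geom_mean_le_arith_mean2_weighted hα.le hβ.le (div_nonneg hF ha0.le)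
    (div_nonneg hG hb0.le) hαβ
  rw [Real.div_rpow hF ha0.le, Real.div_rpow hG hb0.le, div_mul_div_comm] at amgm
  exact (div_le_div_iff_of_pos_right hc0).1 (amgm.trans key)

open SchwartzMap LineDeriv

theorem SchwartzMap.exists_norm_le (h : 𝓢(E2, ℝ)) : ∃ C, ∀ x, ‖h x‖ ≤ C :=
  ⟨_, fun x => norm_le_seminorm ℝ h x⟩

theorem SchwartzMap.integrableOn_exp_neg_mul (h : 𝓢(E2, ℝ)) (e x : E2) :
    IntegrableOn (fun s : ℝ => Real.exp (-s) * h (x - s • e)) (Ioi 0) := by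
  obtain ⟨C, hC⟩ := h.exists_norm_le
  refine Integrable.mul_bdd (c := C) (integrableOn_exp_neg_Ioi 0) ?_ (ae_of_all _ fun s => hC _)
  exact (h.continuous.comp (by fun_prop)).aestronglyMeasurable

/-- A Schwartz function `h` is recovered from `h + ∂_{e} h` by one-sided exponential averaging. -/
theorem SchwartzMap.eq_integral_exp_mul (h : 𝓢(E2, ℝ)) (e x : E2) :
    h x = ∫ s in Ioi (0 : ℝ), Real.exp (-s) * (h + ∂_{e} h) (x - s • e) := by
  have hd : ∀ s ∈ Ici (0 : ℝ), HasDerivAt (fun s : ℝ => -(Real.exp (-s) * h (x - s • e)))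
      (Real.exp (-s) * (h + ∂_{e} h) (x - s • e)) s := by
    intro s _
    have h1 : HasDerivAt (fun s : ℝ => x - s • e) (-e) s := by
      simpa using ((hasDerivAt_id s).smul_const e).const_sub x
    have h2 : HasDerivAt (fun s : ℝ => h (x - s • e)) (fderiv ℝ h (x - s • e) (-e)) s :=
      (h.hasFDerivAt (x - s • e)).comp_hasDerivAt s h1
    have h3 : HasDerivAt (fun s : ℝ => Real.exp (-s)) (-Real.exp (-s)) s := by
      simpa using (hasDerivAt_neg s).exp
    refine (h3.mul h2).neg.congr_deriv ?_
    rw [_root_.add_apply, lineDerivOp_apply_eq_fderiv, map_neg]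
    ring
  have ht : Tendsto (fun s : ℝ => -(Real.exp (-s) * h (x - s • e))) atTop (nhds 0) := by
    obtain ⟨C, hC⟩ := h.exists_norm_le
    have hexp : Tendsto (fun s : ℝ => C * Real.exp (-s)) atTop (nhds 0) := by
      simpa using (Real.tendsto_exp_neg_atTop_nhds_zero).const_mul C
    refine squeeze_zero_norm (fun s => ?_) hexp
    rw [norm_neg, norm_mul, Real.norm_eq_abs, Real.abs_exp, mul_comm]
    exact mul_le_mul_of_nonneg_right (hC _) (Real.exp_pos _).le
  rw [integral_Ioi_of_hasDerivAt_of_tendsto' hd (integrableOn_exp_neg_mul _ e x) ht]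
  simp

theorem hasTemperateGrowth_inv_one_add_sq :
    (fun y : ℝ => (1 + y ^ 2)⁻¹).HasTemperateGrowth := by
  have := Function.hasTemperateGrowth_one_add_norm_sq_rpow ℝ (-1)
  simpa [Real.rpow_neg_one] using this

theorem hasTemperateGrowth_inv_one_add_mul_I (e : E2) :
    (fun ξ : E2 => ((1 : ℂ) + 2 * Real.pi * Complex.I * (inner ℝ ξ e : ℝ))⁻¹).HasTemperateGrowth := by
  have h1 : (fun ξ : E2 => 2 * Real.pi * inner ℝ ξ e).HasTemperateGrowth := by fun_prop
  have h2 : (fun ξ : E2 => (1 + (2 * Real.pi * inner ℝ ξ e) ^ 2)⁻¹).HasTemperateGrowth :=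
    hasTemperateGrowth_inv_one_add_sq.comp h1
  have h3 : (fun ξ : E2 => ((1 + (2 * Real.pi * inner ℝ ξ e) ^ 2)⁻¹ : ℝ) *
      ((1 : ℂ) - Complex.I * (2 * Real.pi * inner ℝ ξ e : ℝ))).HasTemperateGrowth := by
    have h4 := Complex.ofRealCLM.hasTemperateGrowth.comp h2
    have h5 := Complex.ofRealCLM.hasTemperateGrowth.comp h1
    exact h4.mul ((Function.HasTemperateGrowth.const 1).sub
      ((Function.HasTemperateGrowth.const Complex.I).mul h5))
  convert h3 using 2 with ξ
  generalize inner ℝ ξ e = y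
  have hy : (1 + (2 * Real.pi * y) ^ 2 : ℝ) ≠ 0 := by positivity
  have hy' : (1 + (2 * Real.pi * y) ^ 2 : ℂ) ≠ 0 := by exact_mod_cast hy
  have hprod : ((1 : ℂ) + 2 * Real.pi * Complex.I * y) * (1 - Complex.I * (2 * Real.pi * y)) =
      1 + (2 * Real.pi * y) ^ 2 := by
    ring_nf
    simp [Complex.I_sq]
  push_cast
  rw [inv_eq_iff_eq_inv, mul_inv, inv_inv, eq_comm, ← hprod, mul_assoc, mul_inv_cancel₀, mul_one]
  intro h0
  rw [h0, mul_zero] at hprod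
  exact hy' hprod.symm

theorem exists_add_lineDerivOp_eq_complex (e : E2) (w : 𝓢(E2, ℂ)) :
    ∃ h : 𝓢(E2, ℂ), h + ∂_{e} h = w := by
  set m : E2 → ℂ := fun ξ => ((1 : ℂ) + 2 * Real.pi * Complex.I * (inner ℝ ξ e : ℝ))⁻¹ with hm
  have hmt : m.HasTemperateGrowth := hasTemperateGrowth_inv_one_add_mul_I e
  have hi : (fun ξ : E2 => inner ℝ ξ e).HasTemperateGrowth := by fun_prop
  have hic : (fun ξ : E2 => ((inner ℝ ξ e : ℝ) : ℂ)).HasTemperateGrowth :=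
    Complex.ofRealCLM.hasTemperateGrowth.comp hi
  have hs : ((2 * Real.pi * Complex.I) • fun ξ : E2 => ((inner ℝ ξ e : ℝ) : ℂ)).HasTemperateGrowth :=
    (Function.HasTemperateGrowth.const (2 * Real.pi * Complex.I)).mul hic
  refine ⟨fourierMultiplierCLM ℂ m w, ?_⟩
  rw [lineDeriv_eq_fourierMultiplierCLM, ← fourierMultiplierCLM_ofReal ℂ hi]
  change _ + (2 * Real.pi * Complex.I) • (fourierMultiplierCLM ℂ (fun ξ : E2 => ((inner ℝ ξ e : ℝ) : ℂ)) _) = w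
  rw [← smul_apply, ← fourierMultiplierCLM_smul hic,
    fourierMultiplierCLM_fourierMultiplierCLM_apply hs hmt]
  have hone : m + ((2 * Real.pi * Complex.I) • fun ξ : E2 => ((inner ℝ ξ e : ℝ) : ℂ)) * m =
      fun _ => (1 : ℂ) := by
    funext ξ
    simp only [hm, Pi.add_apply, Pi.mul_apply, Pi.smul_apply, smul_eq_mul]
    generalize inner ℝ ξ e = y
    have h0 : (1 : ℂ) + 2 * Real.pi * Complex.I * y ≠ 0 := by
      intro h
      have := congrArg Complex.re h
      simp at this
    field_simp
  have hadd : fourierMultiplierCLM ℂ m w +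
      fourierMultiplierCLM ℂ (((2 * Real.pi * Complex.I) • fun ξ : E2 => ((inner ℝ ξ e : ℝ) : ℂ)) * m) w =
      fourierMultiplierCLM ℂ (m + ((2 * Real.pi * Complex.I) • fun ξ : E2 => ((inner ℝ ξ e : ℝ) : ℂ)) * m) w := by
    simp only [fourierMultiplierCLM_apply]
    rw [smulLeftCLM_add hmt (hs.mul hmt)]
    simp [FourierTransform.fourierInv_add]
  rw [hadd, hone, fourierMultiplierCLM_const]
  simp

theorem exists_add_lineDerivOp_eq (e : E2) (w : 𝓢(E2, ℝ)) :
    ∃ h : 𝓢(E2, ℝ), h + ∂_{e} h = w := by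
  obtain ⟨h, hh⟩ := exists_add_lineDerivOp_eq_complex e (w.postcompCLM Complex.ofRealCLM)
  refine ⟨h.postcompCLM Complex.reCLM, ?_⟩
  ext x
  have hx := congrArg Complex.re (DFunLike.congr_fun hh x)
  simp only [_root_.add_apply, postcompCLM_apply, Complex.add_re, lineDerivOp_apply_eq_fderiv,
    Complex.ofRealCLM_apply, Complex.ofReal_re, Complex.reCLM_apply] at hx ⊢
  rw [← hx]
  congr 1
  have : HasFDerivAt (h.postcompCLM Complex.reCLM) (Complex.reCLM.comp (fderiv ℝ h x)) x :=
    Complex.reCLM.hasFDerivAt.comp x (h.hasFDerivAt x)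
  rw [this.fderiv]
  simp

theorem SchwartzMap.lineDerivOp_comm (h : 𝓢(E2, ℝ)) (a b : E2) :
    ∂_{a} (∂_{b} h) = ∂_{b} (∂_{a} h) := by
  have key : ∀ (a b x : E2), ∂_{a} (∂_{b} h) x = fderiv ℝ (fderiv ℝ h) x a b := by
    intro a b x
    have h2 : HasFDerivAt (∂_{b} h : 𝓢(E2, ℝ)) ((ContinuousLinearMap.apply ℝ ℝ b).comp
        (fderiv ℝ (fderiv ℝ h) x)) x :=
      (ContinuousLinearMap.apply ℝ ℝ b).hasFDerivAt.comp x ((fderivCLM ℝ E2 ℝ h).hasFDerivAt x)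
    rw [lineDerivOp_apply_eq_fderiv, h2.fderiv]
    rfl
  ext x
  rw [key, key]
  exact second_derivative_symmetric (fun y => h.hasFDerivAt y)
    ((fderivCLM ℝ E2 ℝ h).hasFDerivAt x) a b

/-- The operator `1 + ∂_{e}` on Schwartz functions, as a linear equivalence. -/
def oneAddDeriv (e : E2) : 𝓢(E2, ℝ) ≃ₗ[ℝ] 𝓢(E2, ℝ) :=
  LinearEquiv.ofBijective
    (LinearMap.id + (lineDerivOpCLM ℝ 𝓢(E2, ℝ) e).toLinearMap)
    ⟨by
      rw [injective_iff_map_eq_zero]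
      intro h hh
      ext x
      change h + ∂_{e} h = 0 at hh
      rw [h.eq_integral_exp_mul e, hh]
      simp, fun w => exists_add_lineDerivOp_eq e w⟩

theorem oneAddDeriv_apply (e : E2) (h : 𝓢(E2, ℝ)) : oneAddDeriv e h = h + ∂_{e} h := rfl

theorem oneAddDeriv_symm_apply (e : E2) (w : 𝓢(E2, ℝ)) (x : E2) :
    (oneAddDeriv e).symm w x = ∫ s in Ioi (0 : ℝ), Real.exp (-s) * w (x - s • e) := by
  rw [SchwartzMap.eq_integral_exp_mul _ e, ← oneAddDeriv_apply, LinearEquiv.apply_symm_apply]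

theorem oneAddDeriv_symm_nonneg (e : E2) {w : 𝓢(E2, ℝ)} (hw : ∀ x, 0 ≤ w x) (x : E2) :
    0 ≤ (oneAddDeriv e).symm w x := by
  rw [oneAddDeriv_symm_apply]
  exact integral_nonneg fun s => mul_nonneg (Real.exp_pos _).le (hw _)

/-- The hypothesis of the Prékopa–Leindler inequality. -/
def GeomDominates (α β : ℝ) (u v w : E2 → ℝ) : Prop :=
  ∀ x y, u x ^ α * v y ^ β ≤ w (α • x + β • y)

theorem GeomDominates.oneAddDeriv_symm {α β : ℝ} (hα : 0 < α) (hβ : 0 < β) (hαβ : α + β = 1)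
    {u v w : 𝓢(E2, ℝ)} (hu : ∀ x, 0 ≤ u x) (hv : ∀ x, 0 ≤ v x) (hw : ∀ x, 0 ≤ w x)
    (H : GeomDominates α β u v w) (e : E2) :
    GeomDominates α β ((oneAddDeriv e).symm u) ((oneAddDeriv e).symm v)
      ((oneAddDeriv e).symm w) := by
  intro x y
  simp only [oneAddDeriv_symm_apply, ← integral_indicator measurableSet_Ioi]
  have hm : ∀ (u : 𝓢(E2, ℝ)) (x : E2), Measurable
      ((Ioi (0 : ℝ)).indicator fun s => Real.exp (-s) * u (x - s • e)) := fun u x =>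
    (Continuous.measurable (by
      have := u.continuous
      fun_prop)).indicator measurableSet_Ioi
  have hn : ∀ {u : 𝓢(E2, ℝ)} (x : E2), (∀ x, 0 ≤ u x) → ∀ s : ℝ,
      0 ≤ (Ioi (0 : ℝ)).indicator (fun s => Real.exp (-s) * u (x - s • e)) s :=
    fun x hu => indicator_nonneg fun s _ => mul_nonneg (Real.exp_pos _).le (hu _)
  have hb : ∀ (u : 𝓢(E2, ℝ)) (x : E2), BddAbove (range
      ((Ioi (0 : ℝ)).indicator fun s => Real.exp (-s) * u (x - s • e))) := by
    intro u x
    obtain ⟨C, hC⟩ := u.exists_norm_le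
    refine ⟨C, ?_⟩
    rintro _ ⟨s, rfl⟩
    have hC0 : 0 ≤ C := (norm_nonneg _).trans (hC 0)
    refine indicator_le' (g := fun _ => C) (fun s hs => ?_) (fun _ _ => hC0) s
    calc Real.exp (-s) * u (x - s • e) ≤ Real.exp (-s) * C :=
          mul_le_mul_of_nonneg_left ((le_abs_self _).trans (hC _)) (Real.exp_pos _).le
      _ ≤ C := mul_le_of_le_one_left hC0 (Real.exp_le_one_iff.2 (neg_nonpos.2 (le_of_lt hs)))
  refine prekopaLeindler hα hβ hαβ
    ((integrable_indicator_iff measurableSet_Ioi).2 (u.integrableOn_exp_neg_mul e x))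
    ((integrable_indicator_iff measurableSet_Ioi).2 (v.integrableOn_exp_neg_mul e y))
    ((integrable_indicator_iff measurableSet_Ioi).2 (w.integrableOn_exp_neg_mul e _))
    (hm _ _) (hm _ _) (hm _ _) (hn _ hu) (hn _ hv) (hn _ hw) (hb _ _) (hb _ _) fun s t => ?_
  by_cases hs : s ∈ Ioi (0 : ℝ)
  swap
  · rw [indicator_of_notMem hs, Real.zero_rpow hα.ne', zero_mul]
    exact hn _ hw _
  by_cases ht : t ∈ Ioi (0 : ℝ)
  swap
  · rw [indicator_of_notMem ht, Real.zero_rpow hβ.ne', mul_zero]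
    exact hn _ hw _
  have hst : α * s + β * t ∈ Ioi (0 : ℝ) := by
    have h1 : 0 < s := hs
    have h2 : 0 < t := ht
    exact mem_Ioi.2 (by positivity)
  rw [indicator_of_mem hs, indicator_of_mem ht, indicator_of_mem hst,
    Real.mul_rpow (Real.exp_pos _).le (hu _), Real.mul_rpow (Real.exp_pos _).le (hv _),
    ← Real.exp_mul, ← Real.exp_mul]
  calc Real.exp (-s * α) * u (x - s • e) ^ α * (Real.exp (-t * β) * v (y - t • e) ^ β)
      = Real.exp (-(α * s + β * t)) * (u (x - s • e) ^ α * v (y - t • e) ^ β) := by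
        rw [show -(α * s + β * t) = -s * α + -t * β by ring, Real.exp_add]
        ring
    _ ≤ Real.exp (-(α * s + β * t)) * w (α • (x - s • e) + β • (y - t • e)) :=
        mul_le_mul_of_nonneg_left (H _ _) (Real.exp_pos _).le
    _ = _ := by
        congr 2
        module

theorem SchwartzMap.integrable_mul (u v : 𝓢(E2, ℝ)) : Integrable fun x => u x * v x :=
  (u.memLp 2).integrable_mul (v.memLp 2)

/-- The `L²` inner product of real Schwartz functions. -/
def schwartzInner : 𝓢(E2, ℝ) →ₗ[ℝ] 𝓢(E2, ℝ) →ₗ[ℝ] ℝ :=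
  LinearMap.mk₂ ℝ (fun u v => ∫ x, u x * v x)
    (fun u u' v => by
      simp only [_root_.add_apply, add_mul]
      exact integral_add (u.integrable_mul v) (u'.integrable_mul v))
    (fun c u v => by
      simp only [_root_.smul_apply, smul_eq_mul, mul_assoc]
      exact integral_const_mul _ _)
    (fun u v v' => by
      simp only [_root_.add_apply, mul_add]
      exact integral_add (u.integrable_mul v) (u.integrable_mul v'))
    (fun c u v => by
      simp only [_root_.smul_apply, smul_eq_mul, mul_left_comm]
      exact integral_const_mul _ _)

theorem schwartzInner_apply (u v : 𝓢(E2, ℝ)) : schwartzInner u v = ∫ x, u x * v x := rfl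

theorem schwartzInner_comm (u v : 𝓢(E2, ℝ)) : schwartzInner u v = schwartzInner v u := by
  simp only [schwartzInner_apply, mul_comm]

theorem schwartzInner_self_nonneg (u : 𝓢(E2, ℝ)) : 0 ≤ schwartzInner u u :=
  integral_nonneg fun x => mul_self_nonneg (u x)

theorem schwartzInner_nonneg {u v : 𝓢(E2, ℝ)} (hu : ∀ x, 0 ≤ u x) (hv : ∀ x, 0 ≤ v x) :
    0 ≤ schwartzInner u v :=
  integral_nonneg fun x => mul_nonneg (hu x) (hv x)

theorem schwartzInner_lineDerivOp (u v : 𝓢(E2, ℝ)) (e : E2) :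
    schwartzInner u (∂_{e} v) = -schwartzInner (∂_{e} u) v :=
  integral_mul_lineDerivOp_right_eq_neg_left u v e

theorem schwartzInner_self_lineDerivOp (u : 𝓢(E2, ℝ)) (e : E2) :
    schwartzInner u (∂_{e} u) = 0 := by
  have := schwartzInner_lineDerivOp u u e
  rw [schwartzInner_comm (∂_{e} u)] at this
  linarith

theorem schwartzInner_oneAddDeriv (u v : 𝓢(E2, ℝ)) (e : E2) :
    schwartzInner u (oneAddDeriv e v) = schwartzInner (oneAddDeriv (-e) u) v := by
  simp only [oneAddDeriv_apply, map_add, schwartzInner_lineDerivOp, lineDerivOp_left_neg, map_neg,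
    LinearMap.add_apply, LinearMap.neg_apply]

theorem schwartzInner_oneAddDeriv_self (u : 𝓢(E2, ℝ)) (e : E2) :
    schwartzInner (oneAddDeriv e u) (oneAddDeriv e u) =
      schwartzInner u u + schwartzInner (∂_{e} u) (∂_{e} u) := by
  simp only [oneAddDeriv_apply, map_add, LinearMap.add_apply, schwartzInner_self_lineDerivOp,
    schwartzInner_comm (∂_{e} u) u]
  ring

/-- The operator `(1 - ∂_a) (1 - ∂_b)`. -/
def mixedDeriv (a b : E2) (u : 𝓢(E2, ℝ)) : 𝓢(E2, ℝ) := oneAddDeriv (-a) (oneAddDeriv (-b) u)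

/-- The inverse of `(1 - ∂_b ^ 2) (1 - ∂_a ^ 2)` on Schwartz functions. -/
def resolv (a b : E2) : 𝓢(E2, ℝ) ≃ₗ[ℝ] 𝓢(E2, ℝ) :=
  (oneAddDeriv b).symm ≪≫ₗ (oneAddDeriv a).symm ≪≫ₗ (oneAddDeriv (-a)).symm ≪≫ₗ
    (oneAddDeriv (-b)).symm

theorem resolv_apply (a b : E2) (u : 𝓢(E2, ℝ)) :
    resolv a b u = (oneAddDeriv (-b)).symm ((oneAddDeriv (-a)).symm
      ((oneAddDeriv a).symm ((oneAddDeriv b).symm u))) := rfl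

theorem oneAddDeriv_mixedDeriv_resolv (a b : E2) (u : 𝓢(E2, ℝ)) :
    oneAddDeriv b (oneAddDeriv a (mixedDeriv a b (resolv a b u))) = u := by
  simp [mixedDeriv, resolv_apply]

theorem schwartzInner_resolv (a b : E2) (u v : 𝓢(E2, ℝ)) :
    schwartzInner u v = schwartzInner (mixedDeriv a b u) (mixedDeriv a b (resolv a b v)) := by
  conv_lhs => rw [← oneAddDeriv_mixedDeriv_resolv a b v]
  rw [schwartzInner_oneAddDeriv, schwartzInner_oneAddDeriv]
  rfl

theorem schwartzInner_resolv_comm (a b : E2) (u v : 𝓢(E2, ℝ)) :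
    schwartzInner (resolv a b u) v = schwartzInner u (resolv a b v) := by
  rw [schwartzInner_resolv a b, schwartzInner_comm u, schwartzInner_resolv a b _ u,
    schwartzInner_comm]

theorem schwartzInner_mixedDeriv_self (a b : E2) (u : 𝓢(E2, ℝ)) :
    schwartzInner (mixedDeriv a b u) (mixedDeriv a b u) =
      schwartzInner u u + (schwartzInner (∂_{a} u) (∂_{a} u) + schwartzInner (∂_{b} u) (∂_{b} u)) +
        schwartzInner (∂_{a} (∂_{b} u)) (∂_{a} (∂_{b} u)) := by
  have hcomm : ∂_{-a} (oneAddDeriv (-b) u) = oneAddDeriv (-b) (∂_{-a} u) := by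
    rw [oneAddDeriv_apply, oneAddDeriv_apply, lineDerivOp_add, SchwartzMap.lineDerivOp_comm]
  rw [mixedDeriv, schwartzInner_oneAddDeriv_self, hcomm, schwartzInner_oneAddDeriv_self,
    schwartzInner_oneAddDeriv_self, ← SchwartzMap.lineDerivOp_comm u (-a)]
  simp only [lineDerivOp_left_neg, lineDerivOp_neg, map_neg, LinearMap.neg_apply, neg_neg]
  ring

theorem resolv_nonneg (a b : E2) {u : 𝓢(E2, ℝ)} (hu : ∀ x, 0 ≤ u x) (x : E2) :
    0 ≤ resolv a b u x :=
  oneAddDeriv_symm_nonneg _ (oneAddDeriv_symm_nonneg _ (oneAddDeriv_symm_nonneg _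
    (oneAddDeriv_symm_nonneg _ hu))) x

theorem GeomDominates.resolv {α β : ℝ} (hα : 0 < α) (hβ : 0 < β) (hαβ : α + β = 1)
    {u v w : 𝓢(E2, ℝ)} (hu : ∀ x, 0 ≤ u x) (hv : ∀ x, 0 ≤ v x) (hw : ∀ x, 0 ≤ w x)
    (H : GeomDominates α β u v w) (a b : E2) :
    GeomDominates α β (resolv a b u) (resolv a b v) (resolv a b w) := by
  simp only [resolv_apply]
  have h1 := H.oneAddDeriv_symm hα hβ hαβ hu hv hw b
  have h2 := h1.oneAddDeriv_symm hα hβ hαβ (oneAddDeriv_symm_nonneg _ hu)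
    (oneAddDeriv_symm_nonneg _ hv) (oneAddDeriv_symm_nonneg _ hw) a
  have h3 := h2.oneAddDeriv_symm hα hβ hαβ
    (oneAddDeriv_symm_nonneg _ (oneAddDeriv_symm_nonneg _ hu))
    (oneAddDeriv_symm_nonneg _ (oneAddDeriv_symm_nonneg _ hv))
    (oneAddDeriv_symm_nonneg _ (oneAddDeriv_symm_nonneg _ hw)) (-a)
  exact h3.oneAddDeriv_symm hα hβ hαβ
    (oneAddDeriv_symm_nonneg _ (oneAddDeriv_symm_nonneg _ (oneAddDeriv_symm_nonneg _ hu)))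
    (oneAddDeriv_symm_nonneg _ (oneAddDeriv_symm_nonneg _ (oneAddDeriv_symm_nonneg _ hv)))
    (oneAddDeriv_symm_nonneg _ (oneAddDeriv_symm_nonneg _ (oneAddDeriv_symm_nonneg _ hw))) (-b)

/-- Pointwise multiplication by a Schwartz function. -/
def mulSchwartz (χ : 𝓢(E2, ℝ)) : 𝓢(E2, ℝ) →ₗ[ℝ] 𝓢(E2, ℝ) := (smulLeftCLM ℝ χ).toLinearMap

theorem mulSchwartz_apply (χ u : 𝓢(E2, ℝ)) (x : E2) : mulSchwartz χ u x = χ x * u x :=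
  smulLeftCLM_apply_apply χ.hasTemperateGrowth u x

theorem schwartzInner_mulSchwartz (χ u v : 𝓢(E2, ℝ)) :
    schwartzInner (mulSchwartz χ u) v = schwartzInner u (mulSchwartz χ v) := by
  simp only [schwartzInner_apply, mulSchwartz_apply]
  congr 1 with x
  ring

/-- The resolvent cut off by `χ` on both sides. -/
def cutResolv (a b : E2) (χ : 𝓢(E2, ℝ)) : Module.End ℝ 𝓢(E2, ℝ) :=
  mulSchwartz χ ∘ₗ (resolv a b).toLinearMap ∘ₗ mulSchwartz χ

theorem cutResolv_apply (a b : E2) (χ u : 𝓢(E2, ℝ)) :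
    cutResolv a b χ u = mulSchwartz χ (resolv a b (mulSchwartz χ u)) := rfl

theorem schwartzInner_cutResolv (a b : E2) (χ u v : 𝓢(E2, ℝ)) :
    schwartzInner (cutResolv a b χ u) v = schwartzInner u (cutResolv a b χ v) := by
  rw [cutResolv_apply, cutResolv_apply, schwartzInner_mulSchwartz, schwartzInner_resolv_comm,
    schwartzInner_mulSchwartz]

theorem schwartzInner_cutResolv_pow (a b : E2) (χ : 𝓢(E2, ℝ)) (n : ℕ) (u v : 𝓢(E2, ℝ)) :
    schwartzInner ((cutResolv a b χ ^ n) u) v = schwartzInner u ((cutResolv a b χ ^ n) v) := by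
  induction n generalizing u v with
  | zero => rfl
  | succ n ih =>
    rw [pow_succ, Module.End.mul_apply, ih, schwartzInner_cutResolv, ← Module.End.mul_apply,
      ← pow_succ', pow_succ]

theorem schwartzInner_cutResolv_pow_two_mul (a b : E2) (χ : 𝓢(E2, ℝ)) (n : ℕ) (u : 𝓢(E2, ℝ)) :
    schwartzInner u ((cutResolv a b χ ^ (2 * n)) u) =
      schwartzInner ((cutResolv a b χ ^ n) u) ((cutResolv a b χ ^ n) u) := by
  rw [two_mul, pow_add, Module.End.mul_apply, schwartzInner_cutResolv_pow]

theorem cutResolv_pow_nonneg (a b : E2) {χ : 𝓢(E2, ℝ)} (hχ : ∀ x, 0 ≤ χ x) (n : ℕ)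
    {u : 𝓢(E2, ℝ)} (hu : ∀ x, 0 ≤ u x) : ∀ x, 0 ≤ (cutResolv a b χ ^ n) u x := by
  induction n with
  | zero => exact hu
  | succ n ih =>
    intro x
    rw [pow_succ', Module.End.mul_apply, cutResolv_apply, mulSchwartz_apply]
    refine mul_nonneg (hχ x) (resolv_nonneg a b (fun y => ?_) x)
    rw [mulSchwartz_apply]
    exact mul_nonneg (hχ y) (ih y)

theorem GeomDominates.mulSchwartz {α β : ℝ} {χU χV χW u v w : 𝓢(E2, ℝ)}
    (hχU : ∀ x, 0 ≤ χU x) (hχV : ∀ x, 0 ≤ χV x) (hχW : ∀ x, 0 ≤ χW x)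
    (hu : ∀ x, 0 ≤ u x) (hv : ∀ x, 0 ≤ v x)
    (hχ : GeomDominates α β χU χV χW) (H : GeomDominates α β u v w) :
    GeomDominates α β (mulSchwartz χU u) (mulSchwartz χV v) (mulSchwartz χW w) := by
  intro x y
  simp only [mulSchwartz_apply]
  rw [Real.mul_rpow (hχU x) (hu x), Real.mul_rpow (hχV y) (hv y), mul_mul_mul_comm]
  exact mul_le_mul (hχ x y) (H x y)
    (mul_nonneg (Real.rpow_nonneg (hu x) _) (Real.rpow_nonneg (hv y) _)) (hχW _)

theorem GeomDominates.cutResolv_pow {α β : ℝ} (hα : 0 < α) (hβ : 0 < β) (hαβ : α + β = 1)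
    {χU χV χW : 𝓢(E2, ℝ)}
    (hχU : ∀ x, 0 ≤ χU x) (hχV : ∀ x, 0 ≤ χV x) (hχW : ∀ x, 0 ≤ χW x)
    (hχ : GeomDominates α β χU χV χW) (a b : E2) (n : ℕ) :
    GeomDominates α β ((cutResolv a b χU ^ n) χU) ((cutResolv a b χV ^ n) χV)
      ((cutResolv a b χW ^ n) χW) := by
  have hm : ∀ {χ u : 𝓢(E2, ℝ)}, (∀ x, 0 ≤ χ x) → (∀ x, 0 ≤ u x) →
      ∀ x, 0 ≤ _root_.mulSchwartz χ u x := fun h1 h2 x => by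
    rw [mulSchwartz_apply]
    exact mul_nonneg (h1 x) (h2 x)
  induction n with
  | zero => exact hχ
  | succ n ih =>
    have hU := cutResolv_pow_nonneg a b hχU n hχU
    have hV := cutResolv_pow_nonneg a b hχV n hχV
    have hW := cutResolv_pow_nonneg a b hχW n hχW
    simp only [pow_succ', Module.End.mul_apply, cutResolv_apply]
    exact .mulSchwartz hχU hχV hχW (resolv_nonneg a b (hm hχU hU)) (resolv_nonneg a b (hm hχV hV))
      hχ (.resolv hα hβ hαβ (hm hχU hU) (hm hχV hV) (hm hχW hW)
        (.mulSchwartz hχU hχV hχW hU hV hχ ih) a b)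

theorem one_le_schwartzInner_mixedDeriv (a b : E2) {f : 𝓢(E2, ℝ)} (hf : schwartzInner f f = 1) :
    1 ≤ schwartzInner (mixedDeriv a b f) (mixedDeriv a b f) := by
  rw [schwartzInner_mixedDeriv_self, hf]
  have h1 := schwartzInner_self_nonneg (∂_{a} f)
  have h2 := schwartzInner_self_nonneg (∂_{b} f)
  have h3 := schwartzInner_self_nonneg (∂_{a} (∂_{b} f))
  linarith

theorem inv_le_schwartzInner_resolv (a b : E2) {f : 𝓢(E2, ℝ)} (hf : schwartzInner f f = 1) :
    (schwartzInner (mixedDeriv a b f) (mixedDeriv a b f))⁻¹ ≤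
      schwartzInner f (resolv a b f) := by
  set q := schwartzInner (mixedDeriv a b f) (mixedDeriv a b f) with hq
  have hq1 : 1 ≤ q := one_le_schwartzInner_mixedDeriv a b hf
  have hqp : 0 < q := by linarith
  have key := schwartzInner_self_nonneg (mixedDeriv a b f - q • mixedDeriv a b (resolv a b f))
  have h1 : schwartzInner (mixedDeriv a b f) (mixedDeriv a b (resolv a b f)) = 1 := by
    rw [← schwartzInner_resolv, hf]
  have h2 : schwartzInner (mixedDeriv a b (resolv a b f)) (mixedDeriv a b (resolv a b f)) =
      schwartzInner f (resolv a b f) := by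
    rw [← schwartzInner_resolv, schwartzInner_comm]
  simp only [map_sub, map_smul, LinearMap.sub_apply, LinearMap.smul_apply, smul_eq_mul, h1, h2,
    schwartzInner_comm (mixedDeriv a b (resolv a b f)) (mixedDeriv a b f), ← hq] at key
  rw [inv_le_iff_one_le_mul₀ hqp]
  have : 0 ≤ q * (schwartzInner f (resolv a b f) * q - 1) := by linarith
  linarith [nonneg_of_mul_nonneg_right this hqp]

theorem pow_le_schwartzInner_cutResolv_pow (a b : E2) {χ f : 𝓢(E2, ℝ)}
    (hf : schwartzInner f f = 1) (hχf : mulSchwartz χ f = f) (k : ℕ) :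
    (schwartzInner (mixedDeriv a b f) (mixedDeriv a b f))⁻¹ ^ (2 ^ k) ≤
      schwartzInner f ((cutResolv a b χ ^ (2 ^ k)) f) := by
  induction k with
  | zero =>
    rw [pow_zero, pow_one, pow_one, cutResolv_apply, ← schwartzInner_mulSchwartz, hχf]
    exact inv_le_schwartzInner_resolv a b hf
  | succ k ih =>
    rw [pow_succ, mul_comm, schwartzInner_cutResolv_pow_two_mul, mul_comm, pow_mul]
    set c := schwartzInner f ((cutResolv a b χ ^ (2 ^ k)) f) with hc
    have key := schwartzInner_self_nonneg ((cutResolv a b χ ^ (2 ^ k)) f - c • f)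
    simp only [map_sub, map_smul, LinearMap.sub_apply, LinearMap.smul_apply, smul_eq_mul, hf,
      schwartzInner_comm _ f, ← hc] at key
    have h0 := inv_nonneg.2 (schwartzInner_self_nonneg (mixedDeriv a b f))
    calc _ ≤ c ^ 2 := pow_le_pow_left₀ (pow_nonneg h0 _) ih 2
      _ ≤ _ := by linarith

theorem schwartzInner_cutResolv_pow_le (a b : E2) {χ f : 𝓢(E2, ℝ)} (hχ : ∀ x, 0 ≤ χ x) {C : ℝ}
    (hC : ∀ x, |f x| ≤ C * χ x) (n : ℕ) :
    schwartzInner f ((cutResolv a b χ ^ n) f) ≤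
      C ^ 2 * schwartzInner χ ((cutResolv a b χ ^ n) χ) := by
  have hp : ∀ x, 0 ≤ (C • χ + f) x := fun x => by
    have := (abs_le.1 (hC x)).1
    simp only [_root_.add_apply, _root_.smul_apply, smul_eq_mul]
    linarith
  have hm : ∀ x, 0 ≤ (C • χ - f) x := fun x => by
    have := (abs_le.1 (hC x)).2
    simp only [_root_.sub_apply, _root_.smul_apply, smul_eq_mul]
    linarith
  have h1 := schwartzInner_nonneg hm (cutResolv_pow_nonneg a b hχ n hp)
  have h2 := schwartzInner_nonneg hp (cutResolv_pow_nonneg a b hχ n hm)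
  simp only [map_sub, map_add, map_smul, LinearMap.sub_apply, LinearMap.add_apply,
    LinearMap.smul_apply, smul_eq_mul] at h1 h2
  linarith

theorem schwartzInner_cutResolv_self_le (a b : E2) {χ : 𝓢(E2, ℝ)} {μ : ℝ} (hμ : 0 ≤ μ)
    (H : ∀ g : 𝓢(E2, ℝ), (1 + μ) * schwartzInner (mulSchwartz χ g) (mulSchwartz χ g) ≤
      schwartzInner g g + (schwartzInner (∂_{a} g) (∂_{a} g) + schwartzInner (∂_{b} g) (∂_{b} g)))
    (u : 𝓢(E2, ℝ)) :
    schwartzInner (cutResolv a b χ u) (cutResolv a b χ u) ≤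
      ((1 + μ) ^ 2)⁻¹ * schwartzInner u u := by
  have h1 : (1 + μ) * schwartzInner (cutResolv a b χ u) (cutResolv a b χ u) ≤
      schwartzInner u (cutResolv a b χ u) := by
    set g := resolv a b (mulSchwartz χ u) with hg
    have h2 : schwartzInner u (cutResolv a b χ u) =
        schwartzInner (mixedDeriv a b g) (mixedDeriv a b g) := by
      rw [cutResolv_apply, ← schwartzInner_mulSchwartz, schwartzInner_comm,
        schwartzInner_resolv a b]
    rw [h2, schwartzInner_mixedDeriv_self]
    have := schwartzInner_self_nonneg (∂_{a} (∂_{b} g))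
    have := H g
    rw [cutResolv_apply, ← hg]
    linarith
  have key := schwartzInner_self_nonneg (u - (1 + μ) • cutResolv a b χ u)
  simp only [map_sub, map_smul, LinearMap.sub_apply, LinearMap.smul_apply, smul_eq_mul,
    schwartzInner_comm _ u] at key
  rw [inv_mul_eq_div, le_div_iff₀ (by positivity)]
  nlinarith

theorem schwartzInner_cutResolv_pow_two_mul_le (a b : E2) {χ : 𝓢(E2, ℝ)} {μ : ℝ} (hμ : 0 ≤ μ)
    (H : ∀ g : 𝓢(E2, ℝ), (1 + μ) * schwartzInner (mulSchwartz χ g) (mulSchwartz χ g) ≤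
      schwartzInner g g + (schwartzInner (∂_{a} g) (∂_{a} g) + schwartzInner (∂_{b} g) (∂_{b} g)))
    (n : ℕ) :
    schwartzInner χ ((cutResolv a b χ ^ (2 * n)) χ) ≤
      (1 + μ)⁻¹ ^ (2 * n) * schwartzInner χ χ := by
  rw [schwartzInner_cutResolv_pow_two_mul]
  induction n with
  | zero => simp
  | succ n ih =>
    rw [pow_succ', Module.End.mul_apply]
    refine (schwartzInner_cutResolv_self_le a b hμ H _).trans ?_
    rw [mul_add, pow_add, mul_one, mul_comm (_ ^ (2 * n)), mul_assoc, inv_pow]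
    exact mul_le_mul_of_nonneg_left ih (by positivity)

/-- Coordinates on the plane. -/
def planeCoord : (ℝ × ℝ) ≃ᵐ E2 :=
  MeasurableEquiv.finTwoArrow.symm.trans (MeasurableEquiv.toLp 2 (Fin 2 → ℝ))

theorem planeCoord_apply (p : ℝ × ℝ) : planeCoord p = !₂[p.1, p.2] := by
  rfl

theorem measurePreserving_planeCoord : MeasurePreserving planeCoord :=
  (PiLp.volume_preserving_toLp (Fin 2)).comp
    (volume_preserving_finTwoArrow ℝ).symm

theorem continuous_planeCoord : Continuous planeCoord := by
  change Continuous fun p : ℝ × ℝ => (!₂[p.1, p.2] : E2)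
  fun_prop

theorem planeCoord_combo (α β x y x' y' : ℝ) :
    α • planeCoord (x, y) + β • planeCoord (x', y') =
      planeCoord (α * x + β * x', α * y + β * y') := by
  simp only [planeCoord_apply]
  ext i
  fin_cases i <;> simp

theorem SchwartzMap.exists_planeCoord_le (u : 𝓢(E2, ℝ)) :
    ∃ C, ∀ x y, ‖u (planeCoord (x, y))‖ ≤ C * (1 + y ^ 2)⁻¹ := by
  refine ⟨SchwartzMap.seminorm ℝ 0 0 u + SchwartzMap.seminorm ℝ 2 0 u, fun x y => ?_⟩
  rw [← div_eq_mul_inv, le_div_iff₀ (by positivity)]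
  have h1 := u.norm_pow_mul_le_seminorm ℝ 0 (planeCoord (x, y))
  have h2 := u.norm_pow_mul_le_seminorm ℝ 2 (planeCoord (x, y))
  have h3 : y ^ 2 ≤ ‖planeCoord (x, y)‖ ^ 2 := by
    rw [planeCoord_apply, EuclideanSpace.norm_sq_eq]
    simp
    positivity
  rw [pow_zero, one_mul] at h1
  nlinarith [norm_nonneg (u (planeCoord (x, y)))]

theorem SchwartzMap.integrable_slice (u : 𝓢(E2, ℝ)) (x : ℝ) :
    Integrable fun y => u (planeCoord (x, y)) := by
  obtain ⟨C, hC⟩ := u.exists_planeCoord_le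
  refine (integrable_inv_one_add_sq.const_mul C).mono' ?_ (ae_of_all _ fun y => hC x y)
  exact (u.continuous.comp (continuous_planeCoord.comp (by fun_prop))).aestronglyMeasurable

theorem SchwartzMap.integrable_planeCoord (u : 𝓢(E2, ℝ)) :
    Integrable (fun p => u (planeCoord p)) ((volume : Measure ℝ).prod volume) :=
  measurePreserving_planeCoord.integrable_comp_of_integrable u.integrable

theorem SchwartzMap.integral_eq_planeCoord (u : 𝓢(E2, ℝ)) :
    ∫ x, u x = ∫ x, ∫ y, u (planeCoord (x, y)) := by
  rw [← measurePreserving_planeCoord.integral_comp' (g := u)]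
  exact integral_prod _ u.integrable_planeCoord

/-- The Prékopa–Leindler inequality for Schwartz functions on the plane. -/
theorem GeomDominates.integral_le {α β : ℝ} (hα : 0 < α) (hβ : 0 < β) (hαβ : α + β = 1)
    {u v w : 𝓢(E2, ℝ)} (hu : ∀ x, 0 ≤ u x) (hv : ∀ x, 0 ≤ v x) (hw : ∀ x, 0 ≤ w x)
    (H : GeomDominates α β u v w) :
    (∫ x, u x) ^ α * (∫ x, v x) ^ β ≤ ∫ x, w x := by
  have hcont : ∀ (u : 𝓢(E2, ℝ)) (x : ℝ), Continuous fun y => u (planeCoord (x, y)) :=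
    fun u x => u.continuous.comp (continuous_planeCoord.comp (by fun_prop))
  have hmeas : ∀ u : 𝓢(E2, ℝ), Measurable fun x => ∫ y, u (planeCoord (x, y)) := fun u =>
    (StronglyMeasurable.integral_prod_right' (f := fun p => u (planeCoord p))
      (u.continuous.comp continuous_planeCoord).stronglyMeasurable).measurable
  have hslice : ∀ u : 𝓢(E2, ℝ), Integrable fun x => ∫ y, u (planeCoord (x, y)) := fun u =>
    u.integrable_planeCoord.integral_prod_left
  have hbdd : ∀ (u : 𝓢(E2, ℝ)) (x : ℝ), BddAbove (range fun y => u (planeCoord (x, y))) := by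
    intro u x
    obtain ⟨C, hC⟩ := u.exists_norm_le
    exact ⟨C, by rintro _ ⟨y, rfl⟩; exact (le_abs_self _).trans (hC _)⟩
  have hbdd' : ∀ u : 𝓢(E2, ℝ), BddAbove (range fun x => ∫ y, u (planeCoord (x, y))) := by
    intro u
    obtain ⟨C, hC⟩ := u.exists_planeCoord_le
    refine ⟨∫ y : ℝ, C * (1 + y ^ 2)⁻¹, ?_⟩
    rintro _ ⟨x, rfl⟩
    exact integral_mono (u.integrable_slice x) (integrable_inv_one_add_sq.const_mul C)
      fun y => (le_abs_self _).trans (hC x y)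
  simp only [SchwartzMap.integral_eq_planeCoord]
  refine prekopaLeindler hα hβ hαβ (hslice u) (hslice v) (hslice w) (hmeas u) (hmeas v) (hmeas w)
    (fun x => integral_nonneg fun y => hu _) (fun x => integral_nonneg fun y => hv _)
    (fun x => integral_nonneg fun y => hw _) (hbdd' u) (hbdd' v) fun x x' => ?_
  refine prekopaLeindler hα hβ hαβ (u.integrable_slice x) (v.integrable_slice x')
    (w.integrable_slice _) (hcont _ _).measurable (hcont _ _).measurable (hcont _ _).measurable
    (fun _ => hu _) (fun _ => hv _) (fun _ => hw _) (hbdd u x) (hbdd v x') fun y y' => ?_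
  rw [← planeCoord_combo]
  exact H _ _

theorem GeomDominates.schwartzInner_cutResolv_pow_le {α β : ℝ} (hα : 0 < α) (hβ : 0 < β)
    (hαβ : α + β = 1) {χU χV χW : 𝓢(E2, ℝ)}
    (hχU : ∀ x, 0 ≤ χU x) (hχV : ∀ x, 0 ≤ χV x) (hχW : ∀ x, 0 ≤ χW x)
    (hχ : GeomDominates α β χU χV χW) (a b : E2) (n : ℕ) :
    schwartzInner χU ((cutResolv a b χU ^ n) χU) ^ α *
      schwartzInner χV ((cutResolv a b χV ^ n) χV) ^ β ≤
      schwartzInner χW ((cutResolv a b χW ^ n) χW) := by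
  have hU := cutResolv_pow_nonneg a b hχU n hχU
  have hV := cutResolv_pow_nonneg a b hχV n hχV
  have hW := cutResolv_pow_nonneg a b hχW n hχW
  have hm : ∀ {χ u : 𝓢(E2, ℝ)}, (∀ x, 0 ≤ χ x) → (∀ x, 0 ≤ u x) →
      ∀ x, 0 ≤ _root_.mulSchwartz χ u x := fun h1 h2 x => by
    rw [mulSchwartz_apply]
    exact mul_nonneg (h1 x) (h2 x)
  simpa only [schwartzInner_apply, mulSchwartz_apply] using
    (GeomDominates.mulSchwartz hχU hχV hχW hU hV hχ
      (.cutResolv_pow hα hβ hαβ hχU hχV hχW hχ a b n)).integral_le hα hβ hαβ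
      (hm hχU hU) (hm hχV hV) (hm hχW hW)

/-- The `L²` norm squared of the gradient of a Schwartz function. -/
def dirichletEnergy (u : 𝓢(E2, ℝ)) : ℝ :=
  schwartzInner (∂_{(EuclideanSpace.single 0 1 : E2)} u) (∂_{(EuclideanSpace.single 0 1 : E2)} u) +
    schwartzInner (∂_{(EuclideanSpace.single 1 1 : E2)} u) (∂_{(EuclideanSpace.single 1 1 : E2)} u)

theorem dirichletEnergy_nonneg (u : 𝓢(E2, ℝ)) : 0 ≤ dirichletEnergy u :=
  add_nonneg (schwartzInner_self_nonneg _) (schwartzInner_self_nonneg _)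

theorem dirichletEnergy_smul (c : ℝ) (u : 𝓢(E2, ℝ)) :
    dirichletEnergy (c • u) = c ^ 2 * dirichletEnergy u := by
  simp only [dirichletEnergy, lineDerivOp_smul, map_smul, LinearMap.smul_apply, smul_eq_mul]
  ring

theorem integral_norm_gradient_sq (u : 𝓢(E2, ℝ)) :
    ∫ x, ‖gradient u x‖ ^ 2 = dirichletEnergy u := by
  rw [dirichletEnergy, schwartzInner_apply, schwartzInner_apply,
    ← integral_add (SchwartzMap.integrable_mul _ _) (SchwartzMap.integrable_mul _ _)]
  congr 1 with x
  have h : ∀ i, gradient u x i = fderiv ℝ u x (EuclideanSpace.single i 1) := fun i => by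
    rw [← inner_gradient_left, EuclideanSpace.inner_single_right]
    simp
  rw [EuclideanSpace.norm_sq_eq, Fin.sum_univ_two, h, h]
  simp only [lineDerivOp_apply_eq_fderiv, Real.norm_eq_abs, sq_abs]
  ring

theorem eigen_le_dirichletEnergy {W : Set E2} {u : 𝓢(E2, ℝ)} (hu : tsupport u ⊆ W)
    (h1 : schwartzInner u u = 1) : eigen W ≤ dirichletEnergy u := by
  rw [← integral_norm_gradient_sq]
  refine csInf_le ⟨0, ?_⟩ ⟨u, u.smooth', hu, ?_, rfl⟩
  · rintro _ ⟨g, -, -, -, rfl⟩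
    positivity
  · simpa only [sq, ← schwartzInner_apply] using h1

theorem eigen_nonneg (W : Set E2) : 0 ≤ eigen W := by
  refine Real.sInf_nonneg ?_
  rintro _ ⟨g, -, -, -, rfl⟩
  positivity

theorem tsupport_subset_of_eq_zero {u v : E2 → ℝ} (h : ∀ x, v x = 0 → u x = 0) :
    tsupport u ⊆ tsupport v :=
  closure_mono fun x hx hx' => hx (h x hx')

theorem tsupport_smul_subset (c : ℝ) (u : 𝓢(E2, ℝ)) : tsupport (c • u) ⊆ tsupport u :=
  tsupport_subset_of_eq_zero fun x hx => by rw [_root_.smul_apply, hx, smul_zero]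

theorem schwartzInner_normalize {u : 𝓢(E2, ℝ)} (h0 : 0 < schwartzInner u u) :
    schwartzInner ((√(schwartzInner u u))⁻¹ • u) ((√(schwartzInner u u))⁻¹ • u) = 1 := by
  rw [map_smul, map_smul, LinearMap.smul_apply, smul_eq_mul, smul_eq_mul, ← mul_assoc, ← sq,
    inv_pow, Real.sq_sqrt h0.le, inv_mul_cancel₀ h0.ne']

theorem eigen_mul_le_dirichletEnergy {W : Set E2} {u : 𝓢(E2, ℝ)} (hu : tsupport u ⊆ W) :
    eigen W * schwartzInner u u ≤ dirichletEnergy u := by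
  rcases (schwartzInner_self_nonneg u).eq_or_lt with h0 | h0
  · rw [← h0, mul_zero]
    exact dirichletEnergy_nonneg u
  have key := eigen_le_dirichletEnergy ((tsupport_smul_subset _ u).trans hu)
    (schwartzInner_normalize h0)
  rwa [dirichletEnergy_smul, inv_pow, Real.sq_sqrt h0.le, inv_mul_eq_div, le_div_iff₀ h0] at key

theorem lineDerivOp_mulSchwartz (ψ g : 𝓢(E2, ℝ)) (e x : E2) :
    ∂_{e} (mulSchwartz ψ g) x = ∂_{e} ψ x * g x + ψ x * ∂_{e} g x := by
  have h : (mulSchwartz ψ g : E2 → ℝ) = ⇑ψ * ⇑g := funext (mulSchwartz_apply ψ g)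
  rw [lineDerivOp_apply_eq_fderiv, h, ((ψ.hasFDerivAt x).mul (g.hasFDerivAt x)).fderiv]
  simp only [lineDerivOp_apply_eq_fderiv, _root_.add_apply, _root_.smul_apply, smul_eq_mul]
  ring

/-- Localization: the gradient of a cutoff only costs mass where `χ` differs from one. -/
theorem exists_lineDerivOp_mulSchwartz_le {χ ψ : 𝓢(E2, ℝ)} (hχ : ∀ x, χ x ∈ Icc (0 : ℝ) 1)
    (hψ : ∀ x, ψ x ∈ Icc (0 : ℝ) 1) (e : E2) (hd : ∀ x, χ x ≠ 0 → ∂_{e} ψ x = 0)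
    {η : ℝ} (hη : 0 < η) :
    ∃ C, 0 ≤ C ∧ ∀ g : 𝓢(E2, ℝ),
      schwartzInner (∂_{e} (mulSchwartz ψ g)) (∂_{e} (mulSchwartz ψ g)) ≤
        (1 + η) * schwartzInner (∂_{e} g) (∂_{e} g) +
          C * (schwartzInner g g - schwartzInner (mulSchwartz χ g) (mulSchwartz χ g)) := by
  obtain ⟨D, hD⟩ := (∂_{e} ψ).exists_norm_le
  refine ⟨(1 + η⁻¹) * D ^ 2, by positivity, fun g => ?_⟩
  simp only [schwartzInner_apply]
  rw [← integral_sub (SchwartzMap.integrable_mul _ _) (SchwartzMap.integrable_mul _ _),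
    ← integral_const_mul, ← integral_const_mul, ← integral_add]
  rotate_left
  · exact (SchwartzMap.integrable_mul _ _).const_mul _
  · exact ((SchwartzMap.integrable_mul _ _).sub (SchwartzMap.integrable_mul _ _)).const_mul _
  refine integral_mono (SchwartzMap.integrable_mul _ _)
    (((SchwartzMap.integrable_mul _ _).const_mul _).add
      (((SchwartzMap.integrable_mul _ _).sub (SchwartzMap.integrable_mul _ _)).const_mul _))
    fun x => ?_
  simp only [lineDerivOp_mulSchwartz, mulSchwartz_apply]
  have hψ2 : ψ x ^ 2 ≤ 1 := pow_le_one₀ (hψ x).1 (hψ x).2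
  have hχ2 : χ x ^ 2 ≤ 1 := pow_le_one₀ (hχ x).1 (hχ x).2
  have hD2 : ∂_{e} ψ x ^ 2 ≤ D ^ 2 := sq_le_sq.2 ((hD x).trans (le_abs_self _))
  have hdd : ∂_{e} ψ x ^ 2 ≤ D ^ 2 * (1 - χ x ^ 2) := by
    by_cases h : χ x = 0
    · simpa [h] using hD2
    · rw [hd x h]
      have : 0 ≤ D ^ 2 * (1 - χ x ^ 2) := mul_nonneg (sq_nonneg _) (by linarith)
      simpa using this
  set p := ∂_{e} ψ x
  set q := ψ x
  set r := ∂_{e} g x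
  set s := g x
  have hcross : 2 * (p * s) * (q * r) ≤ η⁻¹ * (p * s) ^ 2 + η * (q * r) ^ 2 := by
    have h0 : 0 ≤ η⁻¹ * (p * s - η * (q * r)) ^ 2 := by positivity
    have h1 : η⁻¹ * (p * s - η * (q * r)) ^ 2 =
        η⁻¹ * (p * s) ^ 2 + η * (q * r) ^ 2 - 2 * (p * s) * (q * r) := by
      field_simp
      ring
    linarith
  have h1 : (1 + η⁻¹) * (p * s) ^ 2 ≤ (1 + η⁻¹) * D ^ 2 * (s * s - χ x * s * (χ x * s)) := by
    have := mul_le_mul_of_nonneg_right hdd (sq_nonneg s)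
    have h2 := mul_le_mul_of_nonneg_left this (by positivity : 0 ≤ 1 + η⁻¹)
    linarith
  have h3 : (1 + η) * (q * r) ^ 2 ≤ (1 + η) * (r * r) := by
    have := mul_le_mul_of_nonneg_right hψ2 (sq_nonneg r)
    exact mul_le_mul_of_nonneg_left (by linarith) (by positivity)
  linarith

theorem exists_eigen_mul_le {W : Set E2} {χ ψ : 𝓢(E2, ℝ)} (hχ : ∀ x, χ x ∈ Icc (0 : ℝ) 1)
    (hψ : ∀ x, ψ x ∈ Icc (0 : ℝ) 1) (hψχ : ∀ᶠ x in nhdsSet (tsupport χ), ψ x = 1)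
    (hψW : tsupport ψ ⊆ W) {η : ℝ} (hη : 0 < η) :
    ∃ C, 0 ≤ C ∧ ∀ g : 𝓢(E2, ℝ),
      eigen W * schwartzInner (mulSchwartz χ g) (mulSchwartz χ g) ≤
        (1 + η) * dirichletEnergy g +
          C * (schwartzInner g g - schwartzInner (mulSchwartz χ g) (mulSchwartz χ g)) := by
  have hev : ∀ x, χ x ≠ 0 → ∀ᶠ y in nhds x, ψ y = 1 := fun x hx =>
    eventually_nhdsSet_iff_forall.1 hψχ x (subset_tsupport _ hx)
  have hd : ∀ e x : E2, χ x ≠ 0 → ∂_{e} ψ x = 0 := fun e x hx => by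
    have : (ψ : E2 → ℝ) =ᶠ[nhds x] fun _ => 1 := hev x hx
    rw [lineDerivOp_apply_eq_fderiv, this.fderiv_eq]
    simp
  obtain ⟨C₀, hC₀, h₀⟩ := exists_lineDerivOp_mulSchwartz_le hχ hψ (EuclideanSpace.single 0 1)
    (hd _) hη
  obtain ⟨C₁, hC₁, h₁⟩ := exists_lineDerivOp_mulSchwartz_le hχ hψ (EuclideanSpace.single 1 1)
    (hd _) hη
  refine ⟨C₀ + C₁, by positivity, fun g => ?_⟩
  have hle : schwartzInner (mulSchwartz χ g) (mulSchwartz χ g) ≤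
      schwartzInner (mulSchwartz ψ g) (mulSchwartz ψ g) := by
    refine integral_mono (SchwartzMap.integrable_mul _ _) (SchwartzMap.integrable_mul _ _)
      fun x => ?_
    simp only [mulSchwartz_apply]
    rw [← sq, ← sq, mul_pow, mul_pow]
    refine mul_le_mul_of_nonneg_right ?_ (sq_nonneg _)
    refine pow_le_pow_left₀ (hχ x).1 ?_ 2
    by_cases h : χ x = 0
    · rw [h]
      exact (hψ x).1
    · rw [(hev x h).self_of_nhds]
      exact (hχ x).2
  have hsupp : tsupport (mulSchwartz ψ g) ⊆ W := by
    refine (tsupport_subset_of_eq_zero fun x hx => ?_).trans hψW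
    rw [mulSchwartz_apply, hx, zero_mul]
  have hE := eigen_mul_le_dirichletEnergy hsupp
  have h2 := mul_le_mul_of_nonneg_left hle (eigen_nonneg W)
  have h3 := h₀ g
  have h4 := h₁ g
  simp only [dirichletEnergy] at hE ⊢
  linarith

theorem exists_schwartz_cutoff {K W : Set E2} (hK : IsCompact K) (hW : IsOpen W) (hKW : K ⊆ W) :
    ∃ χ : 𝓢(E2, ℝ), (∀ᶠ x in nhdsSet K, χ x = 1) ∧ HasCompactSupport χ ∧ tsupport χ ⊆ W ∧
      ∀ x, χ x ∈ Icc (0 : ℝ) 1 := by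
  obtain ⟨L, hL, hKL, hLW⟩ := exists_compact_between hK hW hKW
  obtain ⟨f, hf1, hf0, hf⟩ := exists_contMDiffMap_one_nhds_of_subset_interior
    (modelWithCornersSelf ℝ E2) (n := (⊤ : ℕ∞)) hK.isClosed hKL
  have hs : tsupport f ⊆ L := closure_minimal (fun x hx => by
    by_contra h
    exact hx (hf0 x h)) hL.isClosed
  have hc : HasCompactSupport f := hL.of_isClosed_subset (isClosed_tsupport _) hs
  exact ⟨hc.toSchwartzMap f.contMDiff.contDiff, hf1, hc, hs.trans hLW, hf⟩

theorem schwartzInner_lineDerivOp_smul (σ : ℝ) (g : 𝓢(E2, ℝ)) :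
    schwartzInner (∂_{(σ • EuclideanSpace.single 0 1 : E2)} g)
        (∂_{(σ • EuclideanSpace.single 0 1 : E2)} g) +
      schwartzInner (∂_{(σ • EuclideanSpace.single 1 1 : E2)} g)
        (∂_{(σ • EuclideanSpace.single 1 1 : E2)} g) = σ ^ 2 * dirichletEnergy g := by
  simp only [dirichletEnergy, lineDerivOp_left_smul, map_smul, LinearMap.smul_apply, smul_eq_mul]
  ring

theorem le_of_forall_pow_two_pow_le {A B D : ℝ} (hB : 0 < B)
    (h : ∀ k : ℕ, A ^ (2 ^ (k + 1)) ≤ D * B ^ (2 ^ (k + 1))) : A ≤ B := by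
  by_contra! hlt
  have hr : 1 < A / B := (one_lt_div hB).2 hlt
  obtain ⟨n, hn⟩ := ((tendsto_pow_atTop_atTop_of_one_lt hr).eventually_gt_atTop D).exists
  have h1 : (A / B) ^ n ≤ (A / B) ^ (2 ^ (n + 1)) :=
    pow_le_pow_right₀ hr.le ((Nat.le_succ n).trans Nat.lt_two_pow_self.le)
  have h2 : (A / B) ^ (2 ^ (n + 1)) ≤ D := by
    rw [div_pow, div_le_iff₀ (pow_pos hB _)]
    exact h n
  linarith

/-- Brascamp–Lieb comparison of the cut-off resolvents, obtained by power iteration. -/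
theorem GeomDominates.one_add_le {α β : ℝ} (hα : 0 < α) (hβ : 0 < β) (hαβ : α + β = 1)
    {χU χV χW f g : 𝓢(E2, ℝ)}
    (hχU : ∀ x, 0 ≤ χU x) (hχV : ∀ x, 0 ≤ χV x) (hχW : ∀ x, 0 ≤ χW x)
    (hχ : GeomDominates α β χU χV χW) (a b : E2) {μ : ℝ} (hμ : 0 ≤ μ)
    (H : ∀ g : 𝓢(E2, ℝ), (1 + μ) *
        schwartzInner (_root_.mulSchwartz χW g) (_root_.mulSchwartz χW g) ≤
      schwartzInner g g + (schwartzInner (∂_{a} g) (∂_{a} g) + schwartzInner (∂_{b} g) (∂_{b} g)))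
    (hf : schwartzInner f f = 1) (hχf : _root_.mulSchwartz χU f = f) {Cf : ℝ}
    (hCf : ∀ x, |f x| ≤ Cf * χU x)
    (hg : schwartzInner g g = 1) (hχg : _root_.mulSchwartz χV g = g) {Cg : ℝ}
    (hCg : ∀ x, |g x| ≤ Cg * χV x) :
    1 + μ ≤ α * schwartzInner (mixedDeriv a b f) (mixedDeriv a b f) +
      β * schwartzInner (mixedDeriv a b g) (mixedDeriv a b g) := by
  set p := schwartzInner (mixedDeriv a b f) (mixedDeriv a b f) with hp
  set q := schwartzInner (mixedDeriv a b g) (mixedDeriv a b g) with hq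
  have hp0 : 0 < p := by linarith [one_le_schwartzInner_mixedDeriv a b hf]
  have hq0 : 0 < q := by linarith [one_le_schwartzInner_mixedDeriv a b hg]
  have key : p⁻¹ ^ α * q⁻¹ ^ β ≤ (1 + μ)⁻¹ := by
    refine le_of_forall_pow_two_pow_le
      (D := (Cf ^ 2) ^ α * (Cg ^ 2) ^ β * schwartzInner χW χW) (by positivity) fun k => ?_
    set n := 2 ^ (k + 1) with hn
    have hU0 := schwartzInner_nonneg hχU (cutResolv_pow_nonneg a b hχU n hχU)
    have hV0 := schwartzInner_nonneg hχV (cutResolv_pow_nonneg a b hχV n hχV)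
    have h1 := (pow_le_schwartzInner_cutResolv_pow a b hf hχf (k + 1)).trans
      (_root_.schwartzInner_cutResolv_pow_le a b hχU hCf _)
    have h2 := (pow_le_schwartzInner_cutResolv_pow a b hg hχg (k + 1)).trans
      (_root_.schwartzInner_cutResolv_pow_le a b hχV hCg _)
    rw [← hn] at h1 h2
    have h3 := hχ.schwartzInner_cutResolv_pow_le hα hβ hαβ hχU hχV hχW a b n
    have h4 := schwartzInner_cutResolv_pow_two_mul_le a b hμ H (2 ^ k)
    rw [← pow_succ', ← hn] at h4
    set X := schwartzInner χU ((cutResolv a b χU ^ n) χU)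
    set Y := schwartzInner χV ((cutResolv a b χV ^ n) χV)
    calc (p⁻¹ ^ α * q⁻¹ ^ β) ^ n = (p⁻¹ ^ n) ^ α * (q⁻¹ ^ n) ^ β := by
          rw [mul_pow, Real.rpow_pow_comm (by positivity), Real.rpow_pow_comm (by positivity)]
      _ ≤ (Cf ^ 2 * X) ^ α * (Cg ^ 2 * Y) ^ β :=
          mul_le_mul (Real.rpow_le_rpow (by positivity) h1 hα.le)
            (Real.rpow_le_rpow (by positivity) h2 hβ.le) (by positivity) (by positivity)
      _ = (Cf ^ 2) ^ α * (Cg ^ 2) ^ β * (X ^ α * Y ^ β) := by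
          rw [Real.mul_rpow (by positivity) hU0, Real.mul_rpow (by positivity) hV0]
          ring
      _ ≤ (Cf ^ 2) ^ α * (Cg ^ 2) ^ β * ((1 + μ)⁻¹ ^ n * schwartzInner χW χW) :=
          mul_le_mul_of_nonneg_left (h3.trans h4) (by positivity)
      _ = _ := by ring
  rw [Real.inv_rpow hp0.le, Real.inv_rpow hq0.le, ← mul_inv,
    inv_le_inv₀ (by positivity) (by positivity)] at key
  exact key.trans (Real.geom_mean_le_arith_mean2_weighted hα.le hβ.le hp0.le hq0.le hαβ)

/-- The `L²` norm squared of the mixed second derivative. -/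
def mixedEnergy (f : 𝓢(E2, ℝ)) : ℝ :=
  schwartzInner (∂_{(EuclideanSpace.single 0 1 : E2)} (∂_{(EuclideanSpace.single 1 1 : E2)} f))
    (∂_{(EuclideanSpace.single 0 1 : E2)} (∂_{(EuclideanSpace.single 1 1 : E2)} f))

theorem schwartzInner_mixedDeriv_smul (σ : ℝ) {f : 𝓢(E2, ℝ)} (hf : schwartzInner f f = 1) :
    schwartzInner (mixedDeriv (σ • EuclideanSpace.single 0 1) (σ • EuclideanSpace.single 1 1) f)
      (mixedDeriv (σ • EuclideanSpace.single 0 1) (σ • EuclideanSpace.single 1 1) f) =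
    1 + σ ^ 2 * dirichletEnergy f + σ ^ 4 * mixedEnergy f := by
  rw [mixedEnergy, schwartzInner_mixedDeriv_self, hf, schwartzInner_lineDerivOp_smul]
  simp only [lineDerivOp_left_smul, lineDerivOp_smul, map_smul, LinearMap.smul_apply, smul_eq_mul]
  ring

theorem geomDominates_of_cutoff {α β : ℝ} (hα : 0 < α) (hβ : 0 < β) {u v w : E2 → ℝ}
    (hu : ∀ x, u x ∈ Icc (0 : ℝ) 1) (hv : ∀ x, v x ∈ Icc (0 : ℝ) 1) (hw : ∀ x, 0 ≤ w x)
    (h : ∀ x ∈ α • tsupport u + β • tsupport v, w x = 1) : GeomDominates α β u v w := by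
  intro x y
  by_cases hx : u x = 0
  · rw [hx, Real.zero_rpow hα.ne', zero_mul]
    exact hw _
  by_cases hy : v y = 0
  · rw [hy, Real.zero_rpow hβ.ne', mul_zero]
    exact hw _
  rw [h _ (add_mem_add (smul_mem_smul_set (subset_tsupport _ hx))
    (smul_mem_smul_set (subset_tsupport _ hy)))]
  exact mul_le_one₀ (Real.rpow_le_one (hu x).1 (hu x).2 hα.le) (Real.rpow_nonneg (hv y).1 _)
    (Real.rpow_le_one (hv y).1 (hv y).2 hβ.le)

theorem mulSchwartz_eq_self_of_cutoff {χ f : 𝓢(E2, ℝ)}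
    (h : ∀ᶠ x in nhdsSet (tsupport f), χ x = 1) : mulSchwartz χ f = f := by
  ext x
  rw [mulSchwartz_apply]
  by_cases hx : f x = 0
  · rw [hx, mul_zero]
  · rw [h.self_of_nhdsSet x (subset_tsupport _ hx), one_mul]

theorem exists_abs_le_mul_of_cutoff {χ f : 𝓢(E2, ℝ)} (hχ : ∀ x, 0 ≤ χ x)
    (h : ∀ᶠ x in nhdsSet (tsupport f), χ x = 1) : ∃ C, ∀ x, |f x| ≤ C * χ x := by
  obtain ⟨C, hC⟩ := f.exists_norm_le
  have hC0 : 0 ≤ C := (norm_nonneg _).trans (hC 0)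
  refine ⟨C, fun x => ?_⟩
  by_cases hx : f x = 0
  · rw [hx, abs_zero]
    exact mul_nonneg hC0 (hχ x)
  · rw [h.self_of_nhdsSet x (subset_tsupport _ hx), mul_one]
    exact hC x

theorem eigen_add_le_dirichletEnergy {α β : ℝ} (hα : 0 < α) (hβ : 0 < β) (hαβ : α + β = 1)
    {U V : Set E2} (hUo : IsOpen U) (hVo : IsOpen V) {f g : 𝓢(E2, ℝ)}
    (hfc : HasCompactSupport f) (hfU : tsupport f ⊆ U) (hf : schwartzInner f f = 1)
    (hgc : HasCompactSupport g) (hgV : tsupport g ⊆ V) (hg : schwartzInner g g = 1) :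
    eigen (α • U + β • V) ≤ α * dirichletEnergy f + β * dirichletEnergy g := by
  set W := α • U + β • V with hW
  have hWo : IsOpen W := (hVo.smul₀ hβ.ne').add_left
  obtain ⟨χU, hUf, hUc, hUU, hU⟩ := exists_schwartz_cutoff hfc hUo hfU
  obtain ⟨χV, hVg, hVc, hVV, hV⟩ := exists_schwartz_cutoff hgc hVo hgV
  obtain ⟨χW, hWK, hWc, hWW, hW01⟩ := exists_schwartz_cutoff
    ((hUc.isCompact.smul α).add (hVc.isCompact.smul β)) hWo
    (add_subset_add (smul_set_mono hUU) (smul_set_mono hVV))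
  obtain ⟨ψ, hψχ, -, hψW, hψ⟩ := exists_schwartz_cutoff hWc.isCompact hWo hWW
  have hdom : GeomDominates α β χU χV χW :=
    geomDominates_of_cutoff hα hβ hU hV (fun x => (hW01 x).1) hWK.self_of_nhdsSet
  obtain ⟨Cf, hCf⟩ := exists_abs_le_mul_of_cutoff (fun x => (hU x).1) hUf
  obtain ⟨Cg, hCg⟩ := exists_abs_le_mul_of_cutoff (fun x => (hV x).1) hVg
  set S := α * dirichletEnergy f + β * dirichletEnergy g with hS
  have hη : ∀ η : ℝ, 0 < η → eigen W ≤ (1 + η) * S := by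
    intro η hη
    obtain ⟨C, hC0, hC⟩ := exists_eigen_mul_le hW01 hψ hψχ hψW hη
    obtain ⟨c, hc⟩ : ∃ c, ∀ σ : ℝ, 0 < σ → σ ^ 2 * C < 1 + η →
        eigen W / (1 + η) ≤ S + σ ^ 2 * c := by
      refine ⟨α * mixedEnergy f + β * mixedEnergy g, fun σ hσ hσC => ?_⟩
      have hμ : 0 ≤ σ ^ 2 * (eigen W / (1 + η)) := by
        have := eigen_nonneg W
        positivity
      have key := hdom.one_add_le hα hβ hαβ (fun x => (hU x).1) (fun x => (hV x).1)
        (fun x => (hW01 x).1) (σ • EuclideanSpace.single 0 1) (σ • EuclideanSpace.single 1 1) hμ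
        (fun g => ?_) hf (mulSchwartz_eq_self_of_cutoff hUf) hCf hg
        (mulSchwartz_eq_self_of_cutoff hVg) hCg
      · rw [schwartzInner_mixedDeriv_smul σ hf, schwartzInner_mixedDeriv_smul σ hg] at key
        have hσ2 : 0 < σ ^ 2 := by positivity
        refine le_of_mul_le_mul_left (a := σ ^ 2) ?_ hσ2
        rw [hS]
        linear_combination key + hαβ
      · rw [schwartzInner_lineDerivOp_smul]
        have h1 := hC g
        set m := schwartzInner (mulSchwartz χW g) (mulSchwartz χW g)
        have hm : m ≤ schwartzInner g g := by
          refine integral_mono (SchwartzMap.integrable_mul _ _) (SchwartzMap.integrable_mul _ _)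
            fun x => ?_
          simp only [mulSchwartz_apply]
          have := pow_le_one₀ (n := 2) (hW01 x).1 (hW01 x).2
          nlinarith [mul_self_nonneg (g x)]
        have h2 := mul_le_mul_of_nonneg_left h1 (sq_nonneg σ)
        have h3 := mul_le_mul_of_nonneg_right hσC.le (sub_nonneg.2 hm)
        have hη1 : 0 < 1 + η := by positivity
        refine le_of_mul_le_mul_left (a := 1 + η) ?_ hη1
        have h4 : (1 + η) * ((1 + σ ^ 2 * (eigen W / (1 + η))) * m) =
            (1 + η) * m + σ ^ 2 * (eigen W * m) := by
          field_simp
        rw [h4]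
        linarith
    have hlim : Tendsto (fun σ : ℝ => S + σ ^ 2 * c) (nhdsWithin 0 (Ioi 0)) (nhds S) := by
      have : Continuous fun σ : ℝ => S + σ ^ 2 * c := by fun_prop
      simpa using (this.tendsto 0).mono_left nhdsWithin_le_nhds
    have hev : ∀ᶠ σ : ℝ in nhdsWithin 0 (Ioi 0), σ ^ 2 * C < 1 + η := by
      have : Continuous fun σ : ℝ => σ ^ 2 * C := by fun_prop
      refine ((this.tendsto 0).mono_left nhdsWithin_le_nhds).eventually_lt_const ?_
      simp only [ne_eq, OfNat.ofNat_ne_zero, not_false_eq_true, zero_pow, zero_mul]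
      positivity
    have hle : eigen W / (1 + η) ≤ S := ge_of_tendsto hlim (by
      filter_upwards [hev, self_mem_nhdsWithin] with σ h1 h2 using hc σ h2 h1)
    rwa [div_le_iff₀' (by positivity)] at hle
  have hlim : Tendsto (fun η : ℝ => (1 + η) * S) (nhdsWithin 0 (Ioi 0)) (nhds S) := by
    have : Continuous fun η : ℝ => (1 + η) * S := by fun_prop
    simpa using (this.tendsto 0).mono_left nhdsWithin_le_nhds
  exact ge_of_tendsto hlim (by
    filter_upwards [self_mem_nhdsWithin] with η h using hη η h)

theorem exists_schwartz_normalized {U : Set E2} (hUo : IsOpen U) (hUne : U.Nonempty) :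
    ∃ u : 𝓢(E2, ℝ), tsupport u ⊆ U ∧ schwartzInner u u = 1 := by
  obtain ⟨x, hx⟩ := hUne
  obtain ⟨χ, h1, hc, hU, -⟩ := exists_schwartz_cutoff isCompact_singleton hUo
    (singleton_subset_iff.2 hx)
  have hx1 : χ x = 1 := h1.self_of_nhdsSet x rfl
  have hpos : 0 < schwartzInner χ χ :=
    Continuous.integral_pos_of_hasCompactSupport_nonneg_nonzero
      (χ.continuous.mul χ.continuous) hc.mul_left (fun y => mul_self_nonneg (χ y))
      (x := x) (by simp [hx1])
  exact ⟨_, (tsupport_smul_subset _ χ).trans hU, schwartzInner_normalize hpos⟩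

theorem le_eigen {U : Set E2} (hUo : IsOpen U) (hUb : Bornology.IsBounded U) (hUne : U.Nonempty)
    {c : ℝ} (h : ∀ u : 𝓢(E2, ℝ), HasCompactSupport u → tsupport u ⊆ U → schwartzInner u u = 1 →
      c ≤ dirichletEnergy u) : c ≤ eigen U := by
  refine le_csInf ?_ ?_
  · obtain ⟨u, hu, h1⟩ := exists_schwartz_normalized hUo hUne
    exact ⟨_, u, u.smooth', hu, by simpa only [sq, ← schwartzInner_apply] using h1, rfl⟩
  · rintro _ ⟨g, hg, hgU, hg1, rfl⟩
    have hc : HasCompactSupport g :=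
      Metric.isCompact_of_isClosed_isBounded (isClosed_tsupport g) (hUb.subset hgU)
    have key := h (hc.toSchwartzMap hg) hc hgU (by
      simpa only [sq] using! hg1)
    rwa [← integral_norm_gradient_sq] at key

/-- Convexity of the principal Dirichlet eigenvalue along Minkowski combinations
of bounded open convex planar sets. -/
theorem stmt14 (U V : Set E2)
    (hUo : IsOpen U) (hUb : Bornology.IsBounded U) (hUc : Convex ℝ U) (hUne : U.Nonempty)
    (hVo : IsOpen V) (hVb : Bornology.IsBounded V) (hVc : Convex ℝ V) (hVne : V.Nonempty)
    (α : ℝ) (hα : α ∈ Icc (0 : ℝ) 1) :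
    eigen (α • U + (1 - α) • V) ≤ α * eigen U + (1 - α) * eigen V := by
  rcases hα.1.eq_or_lt with rfl | hα0
  · simp [zero_smul_set hUne]
  rcases hα.2.eq_or_lt with rfl | hα1
  · simp [zero_smul_set hVne]
  have hβ : 0 < 1 - α := by linarith
  have hU : (eigen (α • U + (1 - α) • V) - (1 - α) * eigen V) / α ≤ eigen U := by
    refine le_eigen hUo hUb hUne fun f hfc hfU hf => ?_
    have hV : (eigen (α • U + (1 - α) • V) - α * dirichletEnergy f) / (1 - α) ≤ eigen V := by
      refine le_eigen hVo hVb hVne fun g hgc hgV hg => ?_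
      rw [div_le_iff₀' hβ]
      linarith [eigen_add_le_dirichletEnergy hα0 hβ (by ring) hUo hVo hfc hfU hf hgc hgV hg]
    rw [div_le_iff₀' hβ] at hV
    rw [div_le_iff₀' hα0]
    linarith
  rw [div_le_iff₀' hα0] at hU
  linarith
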